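/- If the initial bias satisfies b⁰(i) ∈ [−1,1] for all i, then for every ε > 0 there exists an iteration threshold t₀ such that for all m, n ≥ t₀ and every user i : U, |b^{m}(i) − b^{n}(i)| ≤ ε; in particular the sequence of bias iterates is Cauchy in the supremum norm. -/

import Mathlib

open Finset

noncomputable def clamp (x : ℝ) : ℝ := max 0 (min 1 x)

/-- The set of users rating object `j`. -/
def dminus {U O : Type} [Fintype U] [DecidableEq O] (dplus : U → Finset O) (j : O) :
    Finset U :=
  Finset.univ.filter (fun i => j ∈ dplus i)

/-- The true-rating map `R(b)`. -/
noncomputable def Rmap {U O : Type} [Fintype U] [DecidableEq O] (dplus : U → Finset O)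
    (w : U → O → ℝ) (α : ℝ) (b : U → ℝ) (j : O) : ℝ :=
  (∑ i ∈ dminus dplus j, clamp (w i j - α * b i)) / (dminus dplus j).card

/-- The bias-update map `T(b)`. -/
noncomputable def Tmap {U O : Type} [Fintype U] [DecidableEq O] (dplus : U → Finset O)
    (w : U → O → ℝ) (α : ℝ) (b : U → ℝ) (i : U) : ℝ :=
  (∑ j ∈ dplus i, (w i j - Rmap dplus w α b j)) / (dplus i).card

lemma abs_clamp_sub_clamp_le (x y : ℝ) : |clamp x - clamp y| ≤ |x - y| := by
  unfold clamp
  refine (abs_max_sub_max_le_max 0 (min 1 x) 0 (min 1 y)).trans ?_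
  simpa using abs_min_sub_min_le_max 1 x 1 y

lemma abs_sum_div_card_sub_le {ι : Type*} (s : Finset ι) (f g : ι → ℝ) {C : ℝ} (hC : 0 ≤ C)
    (h : ∀ i ∈ s, |f i - g i| ≤ C) :
    |(∑ i ∈ s, f i) / s.card - (∑ i ∈ s, g i) / s.card| ≤ C := by
  rw [← sub_div, ← Finset.sum_sub_distrib, abs_div, Nat.abs_cast]
  refine div_le_of_le_mul₀ (Nat.cast_nonneg _) hC ?_
  calc |∑ i ∈ s, (f i - g i)| ≤ ∑ i ∈ s, |f i - g i| := Finset.abs_sum_le_sum_abs _ _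
    _ ≤ s.card • C := Finset.sum_le_card_nsmul _ _ _ h
    _ = C * s.card := by rw [nsmul_eq_mul, mul_comm]

lemma abs_Rmap_sub_Rmap_le {U O : Type} [Fintype U] [DecidableEq O] (dplus : U → Finset O)
    (w : U → O → ℝ) {α : ℝ} (hα : 0 ≤ α) (b c : U → ℝ) (j : O) :
    |Rmap dplus w α b j - Rmap dplus w α c j| ≤ α * dist b c := by
  refine abs_sum_div_card_sub_le _ _ _ (by positivity) fun i _ => ?_
  calc |clamp (w i j - α * b i) - clamp (w i j - α * c i)|
      ≤ |(w i j - α * b i) - (w i j - α * c i)| := abs_clamp_sub_clamp_le _ _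
    _ = α * dist (b i) (c i) := by
        rw [Real.dist_eq, ← abs_of_nonneg hα, ← abs_mul, abs_of_nonneg hα, ← abs_neg]
        congr 1
        ring
    _ ≤ α * dist b c := by gcongr; exact dist_le_pi_dist b c i

lemma dist_Tmap_le {U O : Type} [Fintype U] [DecidableEq O] (dplus : U → Finset O)
    (w : U → O → ℝ) {α : ℝ} (hα : 0 ≤ α) (b c : U → ℝ) :
    dist (Tmap dplus w α b) (Tmap dplus w α c) ≤ α * dist b c := by
  refine (dist_pi_le_iff (by positivity)).2 fun i => ?_
  refine abs_sum_div_card_sub_le _ _ _ (by positivity) fun j _ => ?_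
  rw [sub_sub_sub_cancel_left, abs_sub_comm]
  exact abs_Rmap_sub_Rmap_le dplus w hα b c j

theorem bias_iterates_cauchy
    {U O : Type} [Fintype U] [Nonempty U] [Fintype O] [Nonempty O] [DecidableEq O]
    (dplus : U → Finset O) (hd : ∀ i : U, (dplus i).Nonempty)
    (hdm : ∀ j : O, (dminus dplus j).Nonempty)
    (w : U → O → ℝ) (hw : ∀ i j, w i j ∈ Set.Icc (0 : ℝ) 1)
    (α : ℝ) (hα0 : 0 < α) (hα1 : α < 1)
    (b : ℕ → U → ℝ) (hb : ∀ t, b (t + 1) = Tmap dplus w α (b t))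
    (hb0 : ∀ i : U, b 0 i ∈ Set.Icc (-1 : ℝ) 1) :
    ∀ ε : ℝ, 0 < ε → ∃ t₀ : ℕ, ∀ m n : ℕ, t₀ ≤ m → t₀ ≤ n → ∀ i : U,
      |b m i - b n i| ≤ ε := by
  have step : ∀ n, dist (b n) (b (n + 1)) ≤ dist (b 0) (b 1) * α ^ n := by
    intro n
    induction n with
    | zero => simp
    | succ n ih =>
      calc dist (b (n + 1)) (b (n + 1 + 1)) ≤ α * dist (b n) (b (n + 1)) := by
            rw [hb (n + 1)]
            nth_rewrite 1 [hb n]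
            exact dist_Tmap_le dplus w hα0.le _ _
        _ ≤ α * (dist (b 0) (b 1) * α ^ n) := by gcongr
        _ = dist (b 0) (b 1) * α ^ (n + 1) := by ring
  intro ε hε
  obtain ⟨N, hN⟩ := Metric.cauchySeq_iff.1 (cauchySeq_of_le_geometric α _ hα1 step) ε hε
  exact ⟨N, fun m n hm hn i => (dist_le_pi_dist (b m) (b n) i).trans (hN m hm n hn).le⟩
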